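/- arXiv:math/0309109 — 2 statements merged into one kernel-verified Lean document; each statement's English description precedes it below -/
import Mathlib

section
/- Let f ∈ ℤ[x] be a cubic polynomial of nonzero discriminant. There is a constant C_f, depending only on f, such that for every squarefree integer d and any two distinct integer points P = (x,y), P' = (x',y') ∈ ℤ² on the elliptic curve E_d : d y² = f(x), one has ĥ(P + P') ≤ 3·max(ĥ(P), ĥ(P')) + C_f. -/
open Polynomial
open scoped Classical

/-- The naive logarithmic height of a complex number that happens to be rational:
`log max(|num|, den)`; junk value `0` at non-rational inputs. -/
noncomputable def hRat (t : ℂ) : ℝ :=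
  if h : ∃ q : ℚ, (q : ℂ) = t then
    Real.log (max (|h.choose.num| : ℝ) (h.choose.den : ℝ))
  else 0

/-- Duplication on the curve `c Y² = f(x)` (for a cubic `f ∈ ℤ[x]`), with `none` playing
the role of the point at infinity.  Points with `Y = 0` are `2`-torsion and double to the
point at infinity; otherwise `x₂ = (c λ² − a₂)/a₃ − 2x` with `λ = f'(x)/(2cY)`. -/
noncomputable def ecDouble (f : Polynomial ℤ) (c : ℂ) :
    Option (ℂ × ℂ) → Option (ℂ × ℂ)
  | none => none
  | some (x, Y) =>
    if Y = 0 then none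
    else
      let lam : ℂ := (Polynomial.aeval x (f.derivative)) / (2 * c * Y)
      let x₂ : ℂ := (c * lam ^ 2 - (f.coeff 2 : ℂ)) / (f.coeff 3 : ℂ) - 2 * x
      some (x₂, -(lam * (x₂ - x) + Y))

/-- The `x`-coordinate height of a point (with value `0` at the point at infinity). -/
noncomputable def hPoint : Option (ℂ × ℂ) → ℝ
  | none => 0
  | some (x, _) => hRat x

/-- The canonical height on the curve `c Y² = f(x)`:
`ĥ(P) = (1/2) lim_{N→∞} 4^{-N} h_x([2^N] P)` (realized as a `limsup`). -/
noncomputable def canHeight (f : Polynomial ℤ) (c : ℂ) (P : Option (ℂ × ℂ)) : ℝ :=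
  Filter.limsup
    (fun N : ℕ => (1 / 2) * ((4 : ℝ)⁻¹) ^ N * hPoint ((ecDouble f c)^[N] P))
    Filter.atTop


/-- Addition on the curve `c Y² = f(x)`: chord construction for points with distinct
`x`-coordinates, duplication for equal points, and the point at infinity for opposite
points. -/
noncomputable def ecAdd (f : Polynomial ℤ) (c : ℂ) :
    Option (ℂ × ℂ) → Option (ℂ × ℂ) → Option (ℂ × ℂ)
  | none, P => P
  | some (x, y), none => some (x, y)
  | some (x, y), some (x', y') =>
    if x = x' then
      (if y = y' then ecDouble f c (some (x, y)) else none)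
    else
      let lam : ℂ := (y' - y) / (x' - x)
      let x'' : ℂ := (c * lam ^ 2 - (f.coeff 2 : ℂ)) / (f.coeff 3 : ℂ) - x - x'
      some (x'', -(lam * (x'' - x) + y))


/-- Multiplicative naive height of a rational number. -/
noncomputable def mulH (q : ℚ) : ℝ := max (|(q.num : ℝ)|) (q.den : ℝ)

lemma one_le_mulH (q : ℚ) : 1 ≤ mulH q := by
  unfold mulH
  have : (1 : ℝ) ≤ (q.den : ℝ) := by exact_mod_cast q.den_pos
  exact le_max_of_le_right this

lemma hRat_ratCast (q : ℚ) : hRat (q : ℂ) = Real.log (mulH q) := by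
  have h : ∃ r : ℚ, (r : ℂ) = (q : ℂ) := ⟨q, rfl⟩
  have h2 : h.choose = q := by
    have := h.choose_spec
    exact_mod_cast this
  unfold hRat mulH
  rw [dif_pos h, h2]

/-- If `q = F / G` then `F` and `G` are a common multiple of numerator and denominator. -/
lemma mulH_frac (q : ℚ) (F G : ℤ) (hG : G ≠ 0) (hq : q = (F : ℚ) / (G : ℚ)) :
    ∃ g : ℤ, g ≠ 0 ∧ g ∣ F ∧ g ∣ G ∧ mulH q * |(g : ℝ)| = max |(F : ℝ)| |(G : ℝ)| := by
  obtain ⟨g, h1, h2⟩ := Rat.exists_eq_mul_div_num_and_eq_mul_div_den F hG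
  rw [← hq] at h1 h2
  refine ⟨g, ?_, ⟨q.num, by rw [h1]⟩, ⟨q.den, by rw [h2]⟩, ?_⟩
  · rintro rfl
    apply hG
    rw [h2]; simp
  · unfold mulH
    rw [max_mul_of_nonneg _ _ (abs_nonneg _)]
    have e1 : (F : ℝ) = g * q.num := by exact_mod_cast h1
    have e2 : (G : ℝ) = g * q.den := by exact_mod_cast h2
    rw [e1, e2, abs_mul, abs_mul, mul_comm, mul_comm (q.den : ℝ)]
    simp

lemma mulH_frac_le (q : ℚ) (F G : ℤ) (hG : G ≠ 0) (hq : q = (F : ℚ) / (G : ℚ)) :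
    mulH q ≤ max |(F : ℝ)| |(G : ℝ)| := by
  obtain ⟨g, hg, -, -, h⟩ := mulH_frac q F G hG hq
  rw [← h]
  have : (1 : ℝ) ≤ |(g : ℝ)| := by exact_mod_cast Int.one_le_abs hg
  have := one_le_mulH q
  nlinarith

lemma mono_bound (k m n H : ℝ) (i j : ℕ) (hm : |m| ≤ H) (hn : |n| ≤ H) :
    |k * m ^ i * n ^ j| ≤ |k| * H ^ (i + j) := by
  rw [abs_mul, abs_mul, abs_pow, abs_pow, pow_add, mul_assoc]
  have : 0 ≤ H := (abs_nonneg _).trans hm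
  gcongr

lemma cubic_bound (k0 k1 k2 k3 m n H : ℝ) (hm : |m| ≤ H) (hn : |n| ≤ H) :
    |k0 * m ^ 3 + k1 * m ^ 2 * n + k2 * m * n ^ 2 + k3 * n ^ 3|
      ≤ (|k0| + |k1| + |k2| + |k3|) * H ^ 3 := by
  have h0 := mono_bound k0 m n H 3 0 hm hn
  have h1 := mono_bound k1 m n H 2 1 hm hn
  have h2 := mono_bound k2 m n H 1 2 hm hn
  have h3 := mono_bound k3 m n H 0 3 hm hn
  simp only [pow_zero, pow_one, mul_one] at h0 h1 h2 h3
  norm_num at h0 h1 h2 h3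
  have t1 := abs_add_le (k0 * m ^ 3 + k1 * m ^ 2 * n + k2 * m * n ^ 2) (k3 * n ^ 3)
  have t2 := abs_add_le (k0 * m ^ 3 + k1 * m ^ 2 * n) (k2 * m * n ^ 2)
  have t3 := abs_add_le (k0 * m ^ 3) (k1 * m ^ 2 * n)
  simp only [abs_mul, abs_pow] at *
  simp only [← abs_pow m 2, ← abs_pow n 2, abs_sq] at *
  linarith

lemma quartic_bound (k0 k1 k2 k3 k4 m n H : ℝ) (hm : |m| ≤ H) (hn : |n| ≤ H) :
    |k0 * m ^ 4 + k1 * m ^ 3 * n + k2 * m ^ 2 * n ^ 2 + k3 * m * n ^ 3 + k4 * n ^ 4|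
      ≤ (|k0| + |k1| + |k2| + |k3| + |k4|) * H ^ 4 := by
  have h := cubic_bound k0 k1 k2 k3 m n H hm hn
  have h4 := mono_bound k4 m n H 0 4 hm hn
  have hH : 0 ≤ H := (abs_nonneg _).trans hm
  have e : k0 * m ^ 4 + k1 * m ^ 3 * n + k2 * m ^ 2 * n ^ 2 + k3 * m * n ^ 3 + k4 * n ^ 4
      = m * (k0 * m ^ 3 + k1 * m ^ 2 * n + k2 * m * n ^ 2 + k3 * n ^ 3) + k4 * m ^ 0 * n ^ 4 := by
    ring
  rw [e]
  refine (abs_add_le _ _).trans ?_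
  rw [abs_mul]
  have : |m| * |k0 * m ^ 3 + k1 * m ^ 2 * n + k2 * m * n ^ 2 + k3 * n ^ 3|
      ≤ H * ((|k0| + |k1| + |k2| + |k3|) * H ^ 3) := by gcongr
  norm_num at h4 ⊢
  nlinarith

lemma lower_aux (D m n g F G : ℤ) (u1 v1 u2 v2 : ℤ) (H K h2 : ℝ) (hD : D ≠ 0)
    (hcop : IsCoprime m n) (hH : H = max |(m : ℝ)| |(n : ℝ)|) (hH1 : 1 ≤ H)
    (hgF : g ∣ F) (hgG : g ∣ G)
    (e1 : u1 * F + v1 * G = D * m ^ 7) (e2 : u2 * F + v2 * G = D * n ^ 7)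
    (b1 : |(u1 : ℝ)| ≤ K * H ^ 3) (b2 : |(v1 : ℝ)| ≤ K * H ^ 3)
    (b3 : |(u2 : ℝ)| ≤ K * H ^ 3) (b4 : |(v2 : ℝ)| ≤ K * H ^ 3)
    (hh : h2 * |(g : ℝ)| = max |(F : ℝ)| |(G : ℝ)|) (hh1 : 1 ≤ h2) :
    H ^ 4 ≤ 2 * K * h2 := by
  have hg : g ∣ D := by
    have c7 : IsCoprime (m ^ 7) (n ^ 7) := hcop.pow
    obtain ⟨s, t, hst⟩ := c7
    have d1 : g ∣ D * m ^ 7 := e1 ▸ dvd_add (hgF.mul_left _) (hgG.mul_left _)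
    have d2 : g ∣ D * n ^ 7 := e2 ▸ dvd_add (hgF.mul_left _) (hgG.mul_left _)
    have : D = s * (D * m ^ 7) + t * (D * n ^ 7) := by linear_combination -D * hst
    rw [this]
    exact dvd_add (d1.mul_left _) (d2.mul_left _)
  have hgD : |(g : ℝ)| ≤ |(D : ℝ)| := by
    have : |g| ≤ |D| := Int.le_of_dvd (abs_pos.mpr hD) ((abs_dvd_abs _ _).mpr hg)
    exact_mod_cast this
  have hDpos : 0 < |(D : ℝ)| := abs_pos.mpr (by exact_mod_cast hD)
  have hK : 0 ≤ K * H ^ 3 := (abs_nonneg _).trans b1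
  have hF : |(F : ℝ)| ≤ h2 * |(D : ℝ)| :=
    (le_max_left _ _).trans (hh ▸ mul_le_mul_of_nonneg_left hgD (by linarith))
  have hG : |(G : ℝ)| ≤ h2 * |(D : ℝ)| :=
    (le_max_right _ _).trans (hh ▸ mul_le_mul_of_nonneg_left hgD (by linarith))
  have key : ∀ (u v w : ℤ), u * F + v * G = D * w ^ 7 → |(u : ℝ)| ≤ K * H ^ 3 →
      |(v : ℝ)| ≤ K * H ^ 3 → |(w : ℝ)| ^ 7 ≤ 2 * K * h2 * H ^ 3 := by
    intro u v w e bu bv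
    have e' : (D : ℝ) * w ^ 7 = u * F + v * G := by exact_mod_cast e.symm
    have i1 : |(D : ℝ)| * |(w : ℝ)| ^ 7 ≤ |(u : ℝ)| * |(F : ℝ)| + |(v : ℝ)| * |(G : ℝ)| := by
      rw [← abs_pow, ← abs_mul, e', ← abs_mul, ← abs_mul]
      exact abs_add_le _ _
    have i2 : |(u : ℝ)| * |(F : ℝ)| ≤ (K * H ^ 3) * (h2 * |(D : ℝ)|) := by gcongr
    have i3 : |(v : ℝ)| * |(G : ℝ)| ≤ (K * H ^ 3) * (h2 * |(D : ℝ)|) := by gcongr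
    refine le_of_mul_le_mul_left ?_ hDpos
    linarith
  have hw : H ^ 7 ≤ 2 * K * h2 * H ^ 3 := by
    rcases max_choice |(m : ℝ)| |(n : ℝ)| with h | h
    · rw [h] at hH
      have := key u1 v1 m e1 b1 b2
      rwa [← hH] at this
    · rw [h] at hH
      have := key u2 v2 n e2 b3 b4
      rwa [← hH] at this
  have hH3 : 0 < H ^ 3 := by positivity
  refine le_of_mul_le_mul_right ?_ hH3
  calc H ^ 4 * H ^ 3 = H ^ 7 := by ring
    _ ≤ _ := hw

set_option maxHeartbeats 2000000 in
/-- The duplication map changes the height by a factor `4`, up to a bounded amount. -/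
lemma dup_height (a b c e : ℤ) (ha : a ≠ 0)
    (hdisc : 18 * a * b * c * e - 4 * b ^ 3 * e + b ^ 2 * c ^ 2 - 4 * a * c ^ 3
      - 27 * a ^ 2 * e ^ 2 ≠ 0) :
    ∃ K : ℝ, 1 ≤ K ∧ ∀ q q2 : ℚ, (a * q ^ 3 + b * q ^ 2 + c * q + e : ℚ) ≠ 0 →
      q2 = (a ^ 2 * q ^ 4 - 2 * a * c * q ^ 2 - 8 * a * e * q + c ^ 2 - 4 * b * e)
        / (4 * a * (a * q ^ 3 + b * q ^ 2 + c * q + e)) →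
      mulH q2 ≤ K * mulH q ^ 4 ∧ mulH q ^ 4 ≤ K * mulH q2 := by
  set Δ : ℤ := 18 * a * b * c * e - 4 * b ^ 3 * e + b ^ 2 * c ^ 2 - 4 * a * c ^ 3
      - 27 * a ^ 2 * e ^ 2 with hΔ
  -- coefficients of the Bezout forms
  obtain ⟨p0, hp0⟩ : ∃ z : ℤ, z = 4 * a * Δ := ⟨_, rfl⟩
  obtain ⟨p1, hp1⟩ : ∃ z : ℤ, z = 4 * a * ((-20)*a*b*e^2 + a*c^2*e + 8*b^2*c*e - 2*b*c^3) := ⟨_, rfl⟩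
  obtain ⟨p2, hp2⟩ : ∃ z : ℤ, z = 4 * a * ((-22)*a*c*e^2 - 4*b^2*e^2 + 13*b*c^2*e - 3*c^4) := ⟨_, rfl⟩
  obtain ⟨p3, hp3⟩ : ∃ z : ℤ, z = 4 * a * ((-24)*a*e^3 + 12*b*c*e^2 - 3*c^3*e) := ⟨_, rfl⟩
  obtain ⟨r0, hr0⟩ : ∃ z : ℤ, z = 20*a^2*b*e^2 - a^2*c^2*e - 8*a*b^2*c*e + 2*a*b*c^3 := ⟨_, rfl⟩
  obtain ⟨r1, hr1⟩ : ∃ z : ℤ, z = (-32)*a^2*c*e^2 - 16*a*b^2*e^2 + 24*a*b*c^2*e - 5*a*c^4 := ⟨_, rfl⟩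
  obtain ⟨r2, hr2⟩ : ∃ z : ℤ, z = (-192)*a^2*e^3 + 104*a*b*c*e^2 - 26*a*c^3*e - 16*b^3*e^2
      + 8*b^2*c^2*e - b*c^4 := ⟨_, rfl⟩
  obtain ⟨r3, hr3⟩ : ∃ z : ℤ, z = (-96)*a*b*e^3 + 24*a*c^2*e^2 + 48*b^2*c*e^2 - 24*b*c^3*e + 3*c^5 := ⟨_, rfl⟩
  obtain ⟨s1, hs1⟩ : ∃ z : ℤ, z = 4 * a^3 * ((-3)*a^2) := ⟨_, rfl⟩
  obtain ⟨s2, hs2⟩ : ∃ z : ℤ, z = 4 * a^3 * ((-2)*a*b) := ⟨_, rfl⟩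
  obtain ⟨s3, hs3⟩ : ∃ z : ℤ, z = 4 * a^3 * ((-4)*a*c + b^2) := ⟨_, rfl⟩
  obtain ⟨t0, ht0⟩ : ∃ z : ℤ, z = a^2 * (3*a^3) := ⟨_, rfl⟩
  obtain ⟨t1, ht1⟩ : ∃ z : ℤ, z = a^2 * (-a^2*b) := ⟨_, rfl⟩
  obtain ⟨t2, ht2⟩ : ∃ z : ℤ, z = a^2 * (-5*a^2*c) := ⟨_, rfl⟩
  obtain ⟨t3, ht3⟩ : ∃ z : ℤ, z = a^2 * ((-27)*a^2*e + 2*a*b*c) := ⟨_, rfl⟩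
  set K1 : ℝ := (|(p0:ℝ)| + |(p1:ℝ)| + |(p2:ℝ)| + |(p3:ℝ)|)
    + (|(r0:ℝ)| + |(r1:ℝ)| + |(r2:ℝ)| + |(r3:ℝ)|)
    + (|((0:ℤ):ℝ)| + |(s1:ℝ)| + |(s2:ℝ)| + |(s3:ℝ)|)
    + (|(t0:ℝ)| + |(t1:ℝ)| + |(t2:ℝ)| + |(t3:ℝ)|) with hK1
  set K2 : ℝ := (|((a^2:ℤ):ℝ)| + |((0:ℤ):ℝ)| + |((-2*a*c:ℤ):ℝ)| + |((-8*a*e:ℤ):ℝ)|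
      + |((c^2-4*b*e:ℤ):ℝ)|) with hK2
  set K3 : ℝ := (|((0:ℤ):ℝ)| + |((4*a*a:ℤ):ℝ)| + |((4*a*b:ℤ):ℝ)| + |((4*a*c:ℤ):ℝ)|
      + |((4*a*e:ℤ):ℝ)|) with hK3
  have K1n : 0 ≤ K1 := by positivity
  have K2n : 0 ≤ K2 := by positivity
  have K3n : 0 ≤ K3 := by positivity
  refine ⟨1 + 2 * K1 + K2 + K3, by linarith, ?_⟩
  intro q q2 hne hq2
  obtain ⟨m, hm⟩ : ∃ z : ℤ, z = q.num := ⟨_, rfl⟩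
  obtain ⟨n, hn⟩ : ∃ z : ℤ, z = (q.den : ℤ) := ⟨_, rfl⟩
  have hn0 : n ≠ 0 := by rw [hn]; exact_mod_cast q.den_ne_zero
  have hn0' : (n : ℚ) ≠ 0 := by exact_mod_cast hn0
  have hqmn : q = (m : ℚ) / n := by rw [hm, hn]; exact_mod_cast (Rat.num_div_den q).symm
  have hcop : IsCoprime m n := by
    rw [hm, hn, Int.isCoprime_iff_gcd_eq_one]
    simpa [Int.gcd] using q.reduced
  obtain ⟨H, hHq⟩ : ∃ H, H = mulH q := ⟨_, rfl⟩
  have hH1 : 1 ≤ H := hHq ▸ one_le_mulH q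
  have hH : H = max |(m : ℝ)| |(n : ℝ)| := by
    rw [hHq, hm, hn]; unfold mulH; simp
  have hmH : |(m : ℝ)| ≤ H := hH ▸ le_max_left _ _
  have hnH : |(n : ℝ)| ≤ H := hH ▸ le_max_right _ _
  obtain ⟨F, hF⟩ : ∃ z : ℤ, z = (a^2) * m ^ 4 + 0 * m ^ 3 * n + (-2*a*c) * m ^ 2 * n ^ 2
      + (-8*a*e) * m * n ^ 3 + (c^2-4*b*e) * n ^ 4 := ⟨_, rfl⟩
  obtain ⟨G, hG⟩ : ∃ z : ℤ, z = 0 * m ^ 4 + (4*a*a) * m ^ 3 * n + (4*a*b) * m ^ 2 * n ^ 2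
      + (4*a*c) * m * n ^ 3 + (4*a*e) * n ^ 4 := ⟨_, rfl⟩
  have ha' : (a : ℚ) ≠ 0 := by exact_mod_cast ha
  have hGq : (G : ℚ) = 4 * a * (a * q ^ 3 + b * q ^ 2 + c * q + e) * n ^ 4 := by
    rw [hG, hqmn]; push_cast; field_simp; ring
  have hFq : (F : ℚ) = (a ^ 2 * q ^ 4 - 2 * a * c * q ^ 2 - 8 * a * e * q + c ^ 2 - 4 * b * e)
      * n ^ 4 := by
    rw [hF, hqmn]; push_cast; field_simp; ring
  have hG0 : G ≠ 0 := by
    have : (G : ℚ) ≠ 0 := by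
      rw [hGq]
      exact mul_ne_zero (mul_ne_zero (mul_ne_zero (by norm_num) ha') hne) (pow_ne_zero _ hn0')
    exact_mod_cast this
  have hq2' : q2 = (F : ℚ) / G := by
    rw [hq2, hFq, hGq, mul_div_mul_right _ _ (pow_ne_zero 4 hn0')]
  have bF : |(F : ℝ)| ≤ K2 * H ^ 4 := by
    have := quartic_bound ((a^2:ℤ):ℝ) ((0:ℤ):ℝ) ((-2*a*c:ℤ):ℝ) ((-8*a*e:ℤ):ℝ)
      ((c^2-4*b*e:ℤ):ℝ) m n H hmH hnH
    rw [← hK2] at this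
    rw [hF]; exact_mod_cast this
  have bG : |(G : ℝ)| ≤ K3 * H ^ 4 := by
    have := quartic_bound ((0:ℤ):ℝ) ((4*a*a:ℤ):ℝ) ((4*a*b:ℤ):ℝ) ((4*a*c:ℤ):ℝ)
      ((4*a*e:ℤ):ℝ) m n H hmH hnH
    rw [← hK3] at this
    rw [hG]; exact_mod_cast this
  have hH4 : 0 < H ^ 4 := by positivity
  rw [← hHq]
  constructor
  · refine (mulH_frac_le q2 F G hG0 hq2').trans (max_le ?_ ?_)
    · refine bF.trans ?_
      gcongr; linarith
    · refine bG.trans ?_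
      gcongr; linarith
  · obtain ⟨g, hg0, hgF, hgG, hh⟩ := mulH_frac q2 F G hG0 hq2'
    have h21 := one_le_mulH q2
    have hH3 : 0 < H ^ 3 := by positivity
    have main : H ^ 4 ≤ 2 * K1 * mulH q2 := by
      refine lower_aux (4 * a ^ 3 * Δ) m n g F G
        (p0 * m ^ 3 + p1 * m ^ 2 * n + p2 * m * n ^ 2 + p3 * n ^ 3)
        (r0 * m ^ 3 + r1 * m ^ 2 * n + r2 * m * n ^ 2 + r3 * n ^ 3)
        (0 * m ^ 3 + s1 * m ^ 2 * n + s2 * m * n ^ 2 + s3 * n ^ 3)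
        (t0 * m ^ 3 + t1 * m ^ 2 * n + t2 * m * n ^ 2 + t3 * n ^ 3)
        H K1 (mulH q2) (mul_ne_zero (mul_ne_zero (by norm_num) (pow_ne_zero _ ha)) hdisc)
        hcop hH hH1 hgF hgG ?_ ?_ ?_ ?_ ?_ ?_ hh h21
      · rw [hp0, hp1, hp2, hp3, hr0, hr1, hr2, hr3, hF, hG, hΔ]; ring
      · rw [hs1, hs2, hs3, ht0, ht1, ht2, ht3, hF, hG, hΔ]; ring
      · have := cubic_bound (p0:ℝ) p1 p2 p3 m n H hmH hnH
        push_cast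
        refine this.trans ?_
        gcongr
        rw [hK1]
        have x1 : 0 ≤ (|(r0:ℝ)| + |(r1:ℝ)| + |(r2:ℝ)| + |(r3:ℝ)|) := by positivity
        have x2 : 0 ≤ (|((0:ℤ):ℝ)| + |(s1:ℝ)| + |(s2:ℝ)| + |(s3:ℝ)|) := by positivity
        have x3 : 0 ≤ (|(t0:ℝ)| + |(t1:ℝ)| + |(t2:ℝ)| + |(t3:ℝ)|) := by positivity
        linarith
      · have := cubic_bound (r0:ℝ) r1 r2 r3 m n H hmH hnH
        push_cast
        refine this.trans ?_
        gcongr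
        rw [hK1]
        have x1 : 0 ≤ (|(p0:ℝ)| + |(p1:ℝ)| + |(p2:ℝ)| + |(p3:ℝ)|) := by positivity
        have x2 : 0 ≤ (|((0:ℤ):ℝ)| + |(s1:ℝ)| + |(s2:ℝ)| + |(s3:ℝ)|) := by positivity
        have x3 : 0 ≤ (|(t0:ℝ)| + |(t1:ℝ)| + |(t2:ℝ)| + |(t3:ℝ)|) := by positivity
        linarith
      · have := cubic_bound ((0:ℤ):ℝ) s1 s2 s3 m n H hmH hnH
        rw [Int.cast_add, Int.cast_add, Int.cast_add]
        simp only [Int.cast_mul, Int.cast_pow]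
        refine this.trans ?_
        gcongr
        rw [hK1]
        have x1 : 0 ≤ (|(r0:ℝ)| + |(r1:ℝ)| + |(r2:ℝ)| + |(r3:ℝ)|) := by positivity
        have x2 : 0 ≤ (|(p0:ℝ)| + |(p1:ℝ)| + |(p2:ℝ)| + |(p3:ℝ)|) := by positivity
        have x3 : 0 ≤ (|(t0:ℝ)| + |(t1:ℝ)| + |(t2:ℝ)| + |(t3:ℝ)|) := by positivity
        linarith
      · have := cubic_bound (t0:ℝ) t1 t2 t3 m n H hmH hnH
        push_cast
        refine this.trans ?_
        gcongr
        rw [hK1]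
        have x1 : 0 ≤ (|(r0:ℝ)| + |(r1:ℝ)| + |(r2:ℝ)| + |(r3:ℝ)|) := by positivity
        have x2 : 0 ≤ (|((0:ℤ):ℝ)| + |(s1:ℝ)| + |(s2:ℝ)| + |(s3:ℝ)|) := by positivity
        have x3 : 0 ≤ (|(p0:ℝ)| + |(p1:ℝ)| + |(p2:ℝ)| + |(p3:ℝ)|) := by positivity
        linarith
    refine main.trans ?_
    gcongr
    linarith

lemma cubic_aeval {R : Type*} [CommRing R] (f : Polynomial ℤ)
    (hdeg : f.natDegree = 3) (x : R) :
    Polynomial.aeval x f = (f.coeff 3 : R) * x ^ 3 + (f.coeff 2 : R) * x ^ 2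
      + (f.coeff 1 : R) * x + (f.coeff 0 : R) := by
  rw [Polynomial.aeval_eq_sum_range, hdeg]
  simp [Finset.sum_range_succ]
  ring

lemma cubic_deriv_aeval {R : Type*} [CommRing R] (f : Polynomial ℤ)
    (hdeg : f.natDegree = 3) (x : R) :
    Polynomial.aeval x f.derivative = 3 * (f.coeff 3 : R) * x ^ 2 + 2 * (f.coeff 2 : R) * x
      + (f.coeff 1 : R) := by
  have hd : f.derivative.natDegree < 3 := by
    have := Polynomial.natDegree_derivative_lt (p := f) (by omega)
    omega
  rw [Polynomial.aeval_eq_sum_range' hd]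
  simp [Finset.sum_range_succ, Polynomial.coeff_derivative]
  ring

lemma root_bound (f : Polynomial ℤ) (hdeg : f.natDegree = 3) :
    ∃ K : ℝ, 1 ≤ K ∧ ∀ q : ℚ, Polynomial.aeval q f = 0 → mulH q ≤ K := by
  have hf : f ≠ 0 := by rintro rfl; simp at hdeg
  have hfin : (f.rootSet ℚ).Finite := Polynomial.rootSet_finite f ℚ
  obtain ⟨K, hK⟩ := (hfin.image mulH).bddAbove
  refine ⟨max K 1, le_max_right _ _, fun q hq => le_max_of_le_left (hK ⟨q, ?_, rfl⟩)⟩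
  exact (Polynomial.mem_rootSet_of_ne hf).mpr hq

/-- Points of `c Y² = f(x)` with rational `x`-coordinate (or infinity). -/
def GoodPt (f : Polynomial ℤ) (c : ℂ) : Option (ℂ × ℂ) → Prop
  | none => True
  | some (x, Y) => (∃ q : ℚ, (q : ℂ) = x) ∧ c * Y ^ 2 = Polynomial.aeval x f

lemma hPoint_nonneg (f : Polynomial ℤ) (c : ℂ) (P : Option (ℂ × ℂ)) (hP : GoodPt f c P) :
    0 ≤ hPoint P := by
  match P, hP with
  | none, _ => exact le_refl _
  | some (x, Y), ⟨⟨q, hq⟩, _⟩ =>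
    subst hq
    show 0 ≤ hRat _
    rw [hRat_ratCast]
    exact Real.log_nonneg (one_le_mulH q)

lemma double_good (f : Polynomial ℤ) (hdeg : f.natDegree = 3)
    (hdisc : 18 * f.coeff 3 * f.coeff 2 * f.coeff 1 * f.coeff 0
        - 4 * (f.coeff 2) ^ 3 * f.coeff 0
        + (f.coeff 2) ^ 2 * (f.coeff 1) ^ 2
        - 4 * f.coeff 3 * (f.coeff 1) ^ 3
        - 27 * (f.coeff 3) ^ 2 * (f.coeff 0) ^ 2 ≠ 0) :
    ∃ C : ℝ, 0 ≤ C ∧ ∀ c : ℂ, c ≠ 0 → ∀ P, GoodPt f c P →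
      GoodPt f c (ecDouble f c P) ∧ |hPoint (ecDouble f c P) - 4 * hPoint P| ≤ C := by
  have ha : f.coeff 3 ≠ 0 := by
    have hf : f ≠ 0 := by rintro rfl; simp at hdeg
    have := Polynomial.leadingCoeff_ne_zero.mpr hf
    rwa [Polynomial.leadingCoeff, hdeg] at this
  obtain ⟨K, hK1, hK⟩ := dup_height (f.coeff 3) (f.coeff 2) (f.coeff 1) (f.coeff 0) ha hdisc
  obtain ⟨R, hR1, hR⟩ := root_bound f hdeg
  have lK := Real.log_nonneg hK1
  have lR := Real.log_nonneg hR1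
  refine ⟨Real.log K + 4 * Real.log R, by positivity, ?_⟩
  intro c hc P hP
  match P, hP with
  | none, _ =>
    refine ⟨trivial, ?_⟩
    show |(0:ℝ) - 4 * 0| ≤ _
    norm_num
    positivity
  | some (x, Y), ⟨⟨q, hq⟩, hcurve⟩ =>
    subst hq
    have hev : Polynomial.aeval (q : ℂ) f = ((Polynomial.aeval q f : ℚ) : ℂ) := by
      rw [cubic_aeval f hdeg, cubic_aeval f hdeg]; push_cast; ring
    by_cases hY : Y = 0
    · have e : ecDouble f c (some ((q : ℂ), Y)) = none := by simp [ecDouble, hY]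
      rw [e]
      refine ⟨trivial, ?_⟩
      show |(0:ℝ) - 4 * hRat _| ≤ _
      rw [hRat_ratCast]
      have h0 : Polynomial.aeval q f = 0 := by
        rw [hev, hY] at hcurve
        have : ((Polynomial.aeval q f : ℚ) : ℂ) = 0 := by rw [← hcurve]; ring
        exact_mod_cast this
      have h1 := hR q h0
      have h2 := one_le_mulH q
      have h3 := Real.log_nonneg h2
      have h4 := Real.log_le_log (by linarith) h1
      rw [abs_le]; constructor <;> linarith
    · have hfq : Polynomial.aeval q f ≠ 0 := by
        intro h
        rw [hev, h] at hcurve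
        have : c * Y ^ 2 ≠ 0 := mul_ne_zero hc (pow_ne_zero _ hY)
        apply this; rw [hcurve]; simp
      obtain ⟨lam, hlam⟩ : ∃ l : ℂ, l = (Polynomial.aeval (q:ℂ) (f.derivative)) / (2 * c * Y) :=
        ⟨_, rfl⟩
      obtain ⟨x2, hx2⟩ : ∃ z : ℂ,
        z = (c * lam ^ 2 - (f.coeff 2 : ℂ)) / (f.coeff 3 : ℂ) - 2 * (q : ℂ) := ⟨_, rfl⟩
      have e : ecDouble f c (some ((q : ℂ), Y)) = some (x2, -(lam * (x2 - q) + Y)) := by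
        rw [hx2, hlam]; simp [ecDouble, hY]
      have ha' : (f.coeff 3 : ℂ) ≠ 0 := by exact_mod_cast ha
      have haq : (f.coeff 3 : ℚ) ≠ 0 := by exact_mod_cast ha
      have hl : lam * (2 * c * Y) = 3 * (f.coeff 3 : ℂ) * q ^ 2 + 2 * (f.coeff 2 : ℂ) * q
          + (f.coeff 1 : ℂ) := by
        rw [← cubic_deriv_aeval f hdeg, hlam]
        have : 2 * c * Y ≠ 0 := mul_ne_zero (mul_ne_zero two_ne_zero hc) hY
        field_simp
      have hx : (f.coeff 3 : ℂ) * x2 = c * lam ^ 2 - (f.coeff 2 : ℂ)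
          - 2 * (f.coeff 3 : ℂ) * q := by
        rw [hx2]; field_simp
      have hcv := hcurve
      rw [cubic_aeval f hdeg] at hcv
      obtain ⟨q2, hq2⟩ : ∃ r : ℚ, r = ((f.coeff 3) ^ 2 * q ^ 4
          - 2 * (f.coeff 3) * (f.coeff 1) * q ^ 2 - 8 * (f.coeff 3) * (f.coeff 0) * q
          + (f.coeff 1) ^ 2 - 4 * (f.coeff 2) * (f.coeff 0))
        / (4 * (f.coeff 3) * ((f.coeff 3) * q ^ 3 + (f.coeff 2) * q ^ 2
          + (f.coeff 1) * q + (f.coeff 0))) := ⟨_, rfl⟩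
      rw [cubic_aeval f hdeg] at hfq
      have hxq : (q2 : ℂ) = x2 := by
        have hfqc : (f.coeff 3 : ℂ) * q ^ 3 + (f.coeff 2 : ℂ) * q ^ 2
          + (f.coeff 1 : ℂ) * q + (f.coeff 0 : ℂ) ≠ 0 := by exact_mod_cast hfq
        rw [hq2]
        push_cast
        rw [div_eq_iff (mul_ne_zero (mul_ne_zero (by norm_num) ha') hfqc)]
        generalize (f.coeff 3 : ℂ) = a at *
        generalize (f.coeff 2 : ℂ) = b at *
        generalize (f.coeff 1 : ℂ) = c1 at *
        generalize (f.coeff 0 : ℂ) = e0 at *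
        linear_combination (-4 * (a * (q:ℂ)^3 + b * q^2 + c1 * q + e0)) * hx
          + (4 * c * lam ^ 2) * hcv - (lam * (2 * c * Y) + (3 * a * (q:ℂ) ^ 2 + 2 * b * q
          + c1)) * hl
      rw [e]
      refine ⟨⟨⟨q2, hxq⟩, ?_⟩, ?_⟩
      · rw [cubic_aeval f hdeg]
        linear_combination hcv - (x2 - q) ^ 2 * hx + (x2 - q) * hl
      · show |hRat x2 - 4 * hRat q| ≤ _
        rw [← hxq, hRat_ratCast, hRat_ratCast]
        obtain ⟨i1, i2⟩ := hK q q2 hfq hq2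
        have p1 : 0 < mulH q := by linarith [one_le_mulH q]
        have p2 : 0 < mulH q2 := by linarith [one_le_mulH q2]
        have pK : 0 < K := by linarith
        have j1 := Real.log_le_log p2 i1
        have j2 := Real.log_le_log (by positivity) i2
        rw [Real.log_mul (by positivity) (by positivity), Real.log_pow] at j1
        rw [Real.log_mul (by positivity) (by positivity), Real.log_pow] at j2
        push_cast at j1 j2
        rw [abs_le]; constructor <;> linarith

/-- The canonical height differs from half the naive height by a bounded amount. -/
lemma canHeight_bound (f : Polynomial ℤ) (c : ℂ) (C : ℝ)
    (h : ∀ P, GoodPt f c P →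
      GoodPt f c (ecDouble f c P) ∧ |hPoint (ecDouble f c P) - 4 * hPoint P| ≤ C)
    (P : Option (ℂ × ℂ)) (hP : GoodPt f c P) :
    |canHeight f c P - hPoint P / 2| ≤ C := by
  have hC : 0 ≤ C := (abs_nonneg _).trans (h P hP).2
  have good : ∀ N, GoodPt f c ((ecDouble f c)^[N] P) := by
    intro N
    induction N with
    | zero => exact hP
    | succ k ih => rw [Function.iterate_succ_apply']; exact (h _ ih).1
  set u : ℕ → ℝ := fun N => (1 / 2) * ((4 : ℝ)⁻¹) ^ N * hPoint ((ecDouble f c)^[N] P) with hu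
  have bd : ∀ N, |u N - hPoint P / 2| ≤ C * (1 - ((4 : ℝ)⁻¹) ^ N) := by
    intro N
    induction N with
    | zero =>
      have : u 0 - hPoint P / 2 = 0 := by simp only [hu, pow_zero, Function.iterate_zero, id]; ring
      rw [this]; simp
    | succ k ih =>
      have h1 := (h _ (good k)).2
      have e : u (k + 1) - hPoint P / 2 = (u k - hPoint P / 2)
          + (1 / 8) * ((4 : ℝ)⁻¹) ^ k * (hPoint (ecDouble f c ((ecDouble f c)^[k] P))
            - 4 * hPoint ((ecDouble f c)^[k] P)) := by
        simp only [hu]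
        rw [Function.iterate_succ_apply', pow_succ]; ring
      rw [e]
      refine (abs_add_le _ _).trans ?_
      have pk : 0 < ((4 : ℝ)⁻¹) ^ k := by positivity
      rw [abs_mul, abs_of_pos (show 0 < (1 / 8) * ((4 : ℝ)⁻¹) ^ k by positivity), pow_succ]
      have : (1 / 8) * ((4 : ℝ)⁻¹) ^ k * |hPoint (ecDouble f c ((ecDouble f c)^[k] P))
            - 4 * hPoint ((ecDouble f c)^[k] P)| ≤ (1 / 8) * ((4 : ℝ)⁻¹) ^ k * C := by gcongr
      have : 0 ≤ ((4 : ℝ)⁻¹) ^ k * C := by positivity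
      linarith
  have bd' : ∀ N, hPoint P / 2 - C ≤ u N ∧ u N ≤ hPoint P / 2 + C := by
    intro N
    have h1 := bd N
    have pk : 0 < ((4 : ℝ)⁻¹) ^ N := by positivity
    have h2 : C * (1 - ((4 : ℝ)⁻¹) ^ N) ≤ C := by nlinarith
    have h3 := abs_le.mp (h1.trans h2)
    constructor <;> linarith [h3.1, h3.2]
  have bb : Filter.IsBoundedUnder (· ≤ ·) Filter.atTop u :=
    Filter.isBoundedUnder_of ⟨_, fun N => (bd' N).2⟩
  have bb' : Filter.IsBoundedUnder (· ≥ ·) Filter.atTop u :=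
    Filter.isBoundedUnder_of ⟨_, fun N => (bd' N).1⟩
  have up : canHeight f c P ≤ hPoint P / 2 + C :=
    Filter.limsup_le_of_le bb'.isCoboundedUnder_le (Filter.Eventually.of_forall fun N => (bd' N).2)
  have lo : hPoint P / 2 - C ≤ canHeight f c P :=
    Filter.le_limsup_of_frequently_le (Filter.Frequently.of_forall fun N => (bd' N).1) bb
  rw [abs_le]; constructor <;> linarith

lemma mulH_int (x : ℤ) : mulH (x : ℚ) = max |(x : ℝ)| 1 := by
  unfold mulH; simp

/-- Naive height bound for the chord construction at integer points. -/
lemma chord_bound (a b c e : ℤ) (ha : a ≠ 0) :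
    ∃ K : ℝ, 1 ≤ K ∧ ∀ d x y x' y' : ℤ, d * y ^ 2 = a * x ^ 3 + b * x ^ 2 + c * x + e →
      d * y' ^ 2 = a * x' ^ 3 + b * x' ^ 2 + c * x' + e → x ≠ x' → ∀ q : ℚ,
      q = ((d * (y' - y) ^ 2 - b * (x' - x) ^ 2 - a * (x' - x) ^ 2 * (x + x') : ℤ) : ℚ)
        / ((a * (x' - x) ^ 2 : ℤ) : ℚ) →
      mulH q ≤ K * (max (mulH x) (mulH x')) ^ 3 := by
  set S : ℝ := |(a:ℝ)| + |(b:ℝ)| + |(c:ℝ)| + |(e:ℝ)| with hS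
  have hS0 : 0 ≤ S := by positivity
  refine ⟨1 + 4 * S + 4 * |(b:ℝ)| + 8 * |(a:ℝ)|, by
    have := abs_nonneg (a:ℝ); have := abs_nonneg (b:ℝ); linarith, ?_⟩
  intro d x y x' y' h1 h2 hne q hq
  obtain ⟨H, hH⟩ : ∃ H, H = max (mulH x) (mulH x') := ⟨_, rfl⟩
  rw [← hH]
  have hH1 : 1 ≤ H := hH ▸ le_max_of_le_left (one_le_mulH _)
  have hx : |(x:ℝ)| ≤ H := by
    rw [hH, mulH_int]; exact le_max_of_le_left (le_max_left _ _)
  have hx' : |(x':ℝ)| ≤ H := by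
    rw [hH, mulH_int x']; exact le_max_of_le_right (le_max_left _ _)
  have hG0 : a * (x' - x) ^ 2 ≠ 0 := mul_ne_zero ha (pow_ne_zero _ (sub_ne_zero.mpr hne.symm))
  have o : |(1:ℝ)| ≤ H := by simpa using hH1
  have f1 := cubic_bound a b c e x 1 H hx o
  have f2 := cubic_bound a b c e x' 1 H hx' o
  simp only [one_pow, mul_one] at f1 f2
  have h1' : (d:ℝ) * y ^ 2 = a * x ^ 3 + b * x ^ 2 + c * x + e := by exact_mod_cast h1
  have h2' : (d:ℝ) * y' ^ 2 = a * x' ^ 3 + b * x' ^ 2 + c * x' + e := by exact_mod_cast h2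
  rw [← h1', ← hS] at f1
  rw [← h2', ← hS] at f2
  have hSH : 0 ≤ S * H ^ 3 := by positivity
  have f3 : |(d:ℝ) * y * y'| ≤ S * H ^ 3 := by
    refine abs_le_of_sq_le_sq ?_ hSH
    calc ((d:ℝ) * y * y') ^ 2 = (d * y ^ 2) * (d * y' ^ 2) := by ring
      _ ≤ |(d:ℝ) * y ^ 2| * |(d:ℝ) * y' ^ 2| := by rw [← abs_mul]; exact le_abs_self _
      _ ≤ (S * H ^ 3) * (S * H ^ 3) := by gcongr
      _ = _ := by ring
  have g1 : |(x':ℝ) - x| ≤ 2 * H := by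
    have := abs_sub (x':ℝ) x
    linarith
  have g2 : |(x:ℝ) + x'| ≤ 2 * H := by
    have := abs_add_le (x:ℝ) x'
    linarith
  have k1 : |(b:ℝ) * (x' - x) ^ 2| ≤ 4 * |(b:ℝ)| * H ^ 3 := by
    rw [abs_mul, abs_pow]
    calc |(b:ℝ)| * |(x':ℝ) - x| ^ 2 ≤ |(b:ℝ)| * (2 * H) ^ 2 := by gcongr
      _ = 4 * |(b:ℝ)| * H ^ 2 := by ring
      _ ≤ _ := by gcongr <;> norm_num
  have k2 : |(a:ℝ) * (x' - x) ^ 2| ≤ 4 * |(a:ℝ)| * H ^ 2 := by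
    rw [abs_mul, abs_pow]
    calc |(a:ℝ)| * |(x':ℝ) - x| ^ 2 ≤ |(a:ℝ)| * (2 * H) ^ 2 := by gcongr
      _ = _ := by ring
  have k3 : |(a:ℝ) * (x' - x) ^ 2 * (x + x')| ≤ 8 * |(a:ℝ)| * H ^ 3 := by
    rw [abs_mul]
    calc _ ≤ (4 * |(a:ℝ)| * H ^ 2) * (2 * H) := by gcongr
      _ = _ := by ring
  have k4 : 4 * |(a:ℝ)| * H ^ 2 ≤ 4 * |(a:ℝ)| * H ^ 3 := by gcongr <;> norm_num
  have nb : 0 ≤ |(b:ℝ)| * H ^ 3 := by positivity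
  have na : 0 ≤ |(a:ℝ)| * H ^ 3 := by positivity
  have nH : 0 ≤ H ^ 3 := by positivity
  refine (mulH_frac_le q _ _ hG0 hq).trans (max_le ?_ ?_)
  · push_cast
    have ee : (d:ℝ) * (y' - y) ^ 2 - b * (x' - x) ^ 2 - a * (x' - x) ^ 2 * (x + x')
        = d * y ^ 2 + d * y' ^ 2 - 2 * (d * y * y') - b * (x' - x) ^ 2
          - a * (x' - x) ^ 2 * (x + x') := by ring
    rw [ee]
    rw [abs_le] at *
    constructor <;> linarith [f1.1, f1.2, f2.1, f2.2, f3.1, f3.2, k1.1, k1.2, k3.1, k3.2]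
  · push_cast
    refine k2.trans ?_
    linarith

/-- Let `f ∈ ℤ[x]` be a cubic polynomial of nonzero discriminant. There is
a constant `C_f`, depending only on `f`, such that for every squarefree integer `d` and any
two distinct integer points `P = (x, y)`, `P' = (x', y')` on `E_d : d y² = f(x)`, one has
`ĥ(P + P') ≤ 3 · max(ĥ(P), ĥ(P')) + C_f`. -/
theorem stmt11 (f : Polynomial ℤ) (hdeg : f.natDegree = 3)
    (hdisc : 18 * f.coeff 3 * f.coeff 2 * f.coeff 1 * f.coeff 0
        - 4 * (f.coeff 2) ^ 3 * f.coeff 0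
        + (f.coeff 2) ^ 2 * (f.coeff 1) ^ 2
        - 4 * f.coeff 3 * (f.coeff 1) ^ 3
        - 27 * (f.coeff 3) ^ 2 * (f.coeff 0) ^ 2 ≠ 0) :
    ∃ C : ℝ, ∀ d : ℤ, Squarefree d →
      ∀ x y x' y' : ℤ,
        d * y ^ 2 = f.eval x → d * y' ^ 2 = f.eval x' →
        (x, y) ≠ (x', y') →
        canHeight f (d : ℂ)
            (ecAdd f (d : ℂ) (some ((x : ℂ), (y : ℂ))) (some ((x' : ℂ), (y' : ℂ))))
          ≤ 3 * max (canHeight f (d : ℂ) (some ((x : ℂ), (y : ℂ))))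
                    (canHeight f (d : ℂ) (some ((x' : ℂ), (y' : ℂ)))) + C := by
  have ha : f.coeff 3 ≠ 0 := by
    have hf : f ≠ 0 := by rintro rfl; simp at hdeg
    have := Polynomial.leadingCoeff_ne_zero.mpr hf
    rwa [Polynomial.leadingCoeff, hdeg] at this
  obtain ⟨C, hC0, hC⟩ := double_good f hdeg hdisc
  obtain ⟨K, hK1, hK⟩ := chord_bound (f.coeff 3) (f.coeff 2) (f.coeff 1) (f.coeff 0) ha
  have lK := Real.log_nonneg hK1
  refine ⟨4 * C + Real.log K / 2, ?_⟩
  intro d hd x y x' y' h1 h2 hne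
  have hd0 : (d : ℂ) ≠ 0 := by exact_mod_cast hd.ne_zero
  have evz : ∀ z : ℤ, f.eval z = f.coeff 3 * z ^ 3 + f.coeff 2 * z ^ 2 + f.coeff 1 * z
      + f.coeff 0 := by
    intro z
    have := cubic_aeval f hdeg z
    simpa [Polynomial.aeval_def] using this
  rw [evz] at h1 h2
  have c1 : (d:ℂ) * y ^ 2 = f.coeff 3 * x ^ 3 + f.coeff 2 * x ^ 2 + f.coeff 1 * x
      + f.coeff 0 := by exact_mod_cast h1
  have c2 : (d:ℂ) * y' ^ 2 = f.coeff 3 * x' ^ 3 + f.coeff 2 * x' ^ 2 + f.coeff 1 * x'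
      + f.coeff 0 := by exact_mod_cast h2
  have gP : GoodPt f d (some ((x : ℂ), (y : ℂ))) :=
    ⟨⟨(x : ℚ), by push_cast; rfl⟩, by rw [cubic_aeval f hdeg]; exact c1⟩
  have gP' : GoodPt f d (some ((x' : ℂ), (y' : ℂ))) :=
    ⟨⟨(x' : ℚ), by push_cast; rfl⟩, by rw [cubic_aeval f hdeg]; exact c2⟩
  have bP := abs_le.mp (canHeight_bound f d C (hC d hd0) _ gP)
  have bP' := abs_le.mp (canHeight_bound f d C (hC d hd0) _ gP')
  have nP := hPoint_nonneg f d _ gP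
  have nP' := hPoint_nonneg f d _ gP'
  have eP : hPoint (some ((x : ℂ), (y : ℂ))) = Real.log (mulH x) := by
    show hRat _ = _
    rw [← hRat_ratCast]; push_cast; rfl
  have eP' : hPoint (some ((x' : ℂ), (y' : ℂ))) = Real.log (mulH x') := by
    show hRat _ = _
    rw [← hRat_ratCast]; push_cast; rfl
  -- reduce to a bound on the naive height of the sum
  suffices hs : GoodPt f d (ecAdd f (d : ℂ) (some ((x : ℂ), (y : ℂ))) (some ((x' : ℂ), (y' : ℂ))))
      ∧ hPoint (ecAdd f (d : ℂ) (some ((x : ℂ), (y : ℂ))) (some ((x' : ℂ), (y' : ℂ))))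
        ≤ Real.log K + 3 * max (hPoint (some ((x : ℂ), (y : ℂ))))
            (hPoint (some ((x' : ℂ), (y' : ℂ)))) by
    obtain ⟨gS, hS⟩ := hs
    have bS := abs_le.mp (canHeight_bound f d C (hC d hd0) _ gS)
    have l1 := le_max_left (canHeight f (d : ℂ) (some ((x : ℂ), (y : ℂ))))
      (canHeight f (d : ℂ) (some ((x' : ℂ), (y' : ℂ))))
    have l2 := le_max_right (canHeight f (d : ℂ) (some ((x : ℂ), (y : ℂ))))
      (canHeight f (d : ℂ) (some ((x' : ℂ), (y' : ℂ))))
    rcases max_choice (hPoint (some ((x : ℂ), (y : ℂ))))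
            (hPoint (some ((x' : ℂ), (y' : ℂ)))) with hm | hm <;> rw [hm] at hS <;>
      linarith [bS.1, bS.2, bP.1, bP.2, bP'.1, bP'.2]
  by_cases hxx : x = x'
  · have hyy : y ≠ y' := fun h => hne (by rw [hxx, h])
    have hyc : (y : ℂ) ≠ y' := by exact_mod_cast hyy
    have e : ecAdd f (d : ℂ) (some ((x : ℂ), (y : ℂ))) (some ((x' : ℂ), (y' : ℂ))) = none := by
      simp [ecAdd, hxx, hyy]
    rw [e]
    refine ⟨trivial, ?_⟩
    show (0:ℝ) ≤ _
    have := le_max_of_le_left (c := hPoint (some ((x' : ℂ), (y' : ℂ)))) nP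
    linarith
  · have hxc : (x : ℂ) ≠ x' := by exact_mod_cast hxx
    obtain ⟨lam, hlam⟩ : ∃ l : ℂ, l = ((y':ℂ) - y) / (x' - x) := ⟨_, rfl⟩
    obtain ⟨x2, hx2⟩ : ∃ z : ℂ,
        z = ((d:ℂ) * lam ^ 2 - (f.coeff 2 : ℂ)) / (f.coeff 3 : ℂ) - x - x' := ⟨_, rfl⟩
    have e : ecAdd f (d : ℂ) (some ((x : ℂ), (y : ℂ))) (some ((x' : ℂ), (y' : ℂ)))
        = some (x2, -(lam * (x2 - x) + y)) := by
      rw [hx2, hlam]; simp [ecAdd, hxx]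
    have ha' : (f.coeff 3 : ℂ) ≠ 0 := by exact_mod_cast ha
    have hxs : (x' : ℂ) - x ≠ 0 := sub_ne_zero.mpr hxc.symm
    have hl : lam * ((x':ℂ) - x) = y' - y := by rw [hlam]; field_simp
    have hx : (f.coeff 3 : ℂ) * x2 = d * lam ^ 2 - (f.coeff 2 : ℂ)
        - (f.coeff 3 : ℂ) * x - (f.coeff 3 : ℂ) * x' := by
      rw [hx2]; field_simp
    obtain ⟨q, hq⟩ : ∃ q : ℚ, q = ((d * (y' - y) ^ 2 - f.coeff 2 * (x' - x) ^ 2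
        - f.coeff 3 * (x' - x) ^ 2 * (x + x') : ℤ) : ℚ)
        / ((f.coeff 3 * (x' - x) ^ 2 : ℤ) : ℚ) := ⟨_, rfl⟩
    have hqx : (q : ℂ) = x2 := by
      rw [hq]
      push_cast
      rw [div_eq_iff (mul_ne_zero ha' (pow_ne_zero _ hxs))]
      linear_combination (-((x':ℂ) - x) ^ 2) * hx
        - d * (lam * ((x':ℂ) - x) + (y' - y)) * hl
    rw [e]
    refine ⟨⟨⟨q, hqx⟩, ?_⟩, ?_⟩
    · rw [cubic_aeval f hdeg]
      have hbr : ((x':ℂ) - x) * ((3 * f.coeff 3 * x ^ 2 + 2 * f.coeff 2 * x + f.coeff 1)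
          + (3 * f.coeff 3 * x + f.coeff 2) * (x' - x) + f.coeff 3 * (x' - x) ^ 2
          - d * lam ^ 2 * (x' - x) - 2 * d * lam * y) = 0 := by
        linear_combination c1 - c2 - d * (lam * ((x':ℂ) - x) + y + y') * hl
      have hbr' := (mul_eq_zero.mp hbr).resolve_left hxs
      linear_combination c1 - (x2 - x) * hbr' - (x2 - x) * (x2 - x') * hx
    · rw [eP, eP']
      show hRat x2 ≤ _
      rw [← hqx, hRat_ratCast]
      have hb := hK d x y x' y' h1 h2 hxx q hq
      have p1 := one_le_mulH x
      have p2 := one_le_mulH x'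
      have p3 := one_le_mulH q
      have lb := Real.log_le_log (by linarith) hb
      have pm : 0 < max (mulH x) (mulH x') := lt_max_of_lt_left (by linarith)
      rw [Real.log_mul (by positivity) (by positivity), Real.log_pow] at lb
      refine lb.trans ?_
      push_cast
      have : Real.log (max (mulH x) (mulH x')) ≤ max (Real.log (mulH x)) (Real.log (mulH x')) := by
        rcases max_choice (mulH x) (mulH x') with h | h <;> rw [h]
        · exact le_max_left _ _
        · exact le_max_right _ _
      linarith
end

section
/- Let f ∈ ℤ[x] be an irreducible polynomial of degree 3 and K = ℚ(α) for a root α of f. Then there are no integer solutions (x,y) to d y² = f(x) with y ≠ 0 whenever the squarefree integer d is divisible by some prime p that is inert (unsplit) in K/ℚ and does not divide the discriminant of f or its leading coefficient. -/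
open Polynomial

/-- If `κ = p δ` with `δ` integral generates the cubic field `K` and is a root of a monic integral
cubic, then `p` divides the `X^2` coefficient and the `X` coefficient. -/
lemma cubic_aux (K : Type*) [Field K] [NumberField K] (hfin : Module.finrank ℚ K = 3)
    (κ δ : K) (p : ℤ) (hp0 : p ≠ 0) (hδ : IsIntegral ℤ δ) (hκ : κ = p * δ)
    (hgen : IntermediateField.adjoin ℚ {κ} = ⊤) (s t u : ℤ)
    (h : κ ^ 3 + s * κ ^ 2 + t * κ + u = 0) : p ∣ s ∧ p ∣ t := by
  have hpK : (p : K) ≠ 0 := by exact_mod_cast hp0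
  have hdegκ : (minpoly ℚ κ).natDegree = 3 := by
    rw [← hfin]; exact (Field.primitive_element_iff_minpoly_natDegree_eq ℚ κ).1 hgen
  have hgenδ : IntermediateField.adjoin ℚ {δ} = ⊤ := by
    rw [eq_top_iff, ← hgen, IntermediateField.adjoin_simple_le_iff, hκ]
    exact mul_mem (intCast_mem _ p) (IntermediateField.mem_adjoin_simple_self ℚ δ)
  have hdegδ : (minpoly ℚ δ).natDegree = 3 := by
    rw [← hfin]; exact (Field.primitive_element_iff_minpoly_natDegree_eq ℚ δ).1 hgenδ
  have hZ : minpoly ℚ δ = (minpoly ℤ δ).map (algebraMap ℤ ℚ) :=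
    minpoly.isIntegrallyClosed_eq_field_fractions' ℚ hδ
  have hmon := minpoly.monic hδ
  have hdegZ : (minpoly ℤ δ).natDegree = 3 := by
    rw [← hdegδ, hZ, hmon.natDegree_map]
  have hr : aeval δ (minpoly ℤ δ) = 0 := minpoly.aeval ℤ δ
  have hl : (minpoly ℤ δ).coeff 3 = 1 := by
    have := hmon.coeff_natDegree
    rwa [hdegZ] at this
  rw [aeval_eq_sum_range, hdegZ] at hr
  simp [Finset.sum_range_succ, hl] at hr
  set s' := (minpoly ℤ δ).coeff 2
  set t' := (minpoly ℤ δ).coeff 1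
  set u' := (minpoly ℤ δ).coeff 0
  let q : ℚ[X] := C ((s - p * s' : ℤ) : ℚ) * X ^ 2 + C ((t - p ^ 2 * t' : ℤ) : ℚ) * X
    + C ((u - p ^ 3 * u' : ℤ) : ℚ)
  have hq : aeval κ q = 0 := by
    simp only [q, map_add, map_mul, aeval_C, map_pow, aeval_X, map_intCast]
    push_cast
    subst hκ
    linear_combination h - (p : K) ^ 3 * hr
  have hq0 : q = 0 := by
    by_contra hne
    have h1 := natDegree_le_of_dvd (minpoly.dvd ℚ κ hq) hne
    have h2 : q.natDegree ≤ 2 := by simp only [q]; compute_degree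
    omega
  have c2 : q.coeff 2 = ((s - p * s' : ℤ) : ℚ) := by
    simp only [q, coeff_add, coeff_C_mul, coeff_X_pow, coeff_X, coeff_C]; norm_num
  have c1 : q.coeff 1 = ((t - p ^ 2 * t' : ℤ) : ℚ) := by
    simp only [q, coeff_add, coeff_C_mul, coeff_X_pow, coeff_X, coeff_C]; norm_num
  rw [hq0, coeff_zero] at c1 c2
  have e2 : s - p * s' = 0 := by exact_mod_cast c2.symm
  have e1 : t - p ^ 2 * t' = 0 := by exact_mod_cast c1.symm
  exact ⟨⟨s', by linarith⟩, ⟨p * t', by linarith⟩⟩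

/-- Let `f ∈ ℤ[x]` be an irreducible cubic polynomial and `K = ℚ(α)` for a
root `α` of `f`. Then there are no integer solutions `(x, y)` with `y ≠ 0` to `d y² = f(x)`
whenever the squarefree integer `d` is divisible by some prime `p` that is inert (unsplit)
in `K/ℚ` and divides neither the discriminant of `f` nor its leading coefficient. -/
theorem stmt17 (f : Polynomial ℤ) (hdeg : f.natDegree = 3)
    (hirr : Irreducible (f.map (Int.castRingHom ℚ)))
    (K : Type*) [Field K] [NumberField K] (α : K)
    (hroot : Polynomial.aeval α f = 0)
    (hgen : IntermediateField.adjoin ℚ {α} = ⊤)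
    (p : ℕ) (hp : p.Prime)
    (hinert : (Ideal.span {(p : NumberField.RingOfIntegers K)}).IsPrime)
    (hdisc : ¬ ((p : ℤ) ∣
      (18 * f.coeff 3 * f.coeff 2 * f.coeff 1 * f.coeff 0
        - 4 * (f.coeff 2) ^ 3 * f.coeff 0
        + (f.coeff 2) ^ 2 * (f.coeff 1) ^ 2
        - 4 * f.coeff 3 * (f.coeff 1) ^ 3
        - 27 * (f.coeff 3) ^ 2 * (f.coeff 0) ^ 2)))
    (hlc : ¬ ((p : ℤ) ∣ f.coeff 3)) :
    ∀ d : ℤ, Squarefree d → (p : ℤ) ∣ d →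
      ¬ ∃ x y : ℤ, y ≠ 0 ∧ d * y ^ 2 = f.eval x := by
  rintro d hsq hpd ⟨x, y, hy, hxy⟩
  have hpp : Prime (p : ℤ) := Nat.prime_iff_prime_int.1 hp
  have hp0 : (p : ℤ) ≠ 0 := hpp.ne_zero
  have ha0 : f.coeff 3 ≠ 0 := fun h => hlc (h ▸ dvd_zero _)
  have hfx : f.eval x = f.coeff 3 * x ^ 3 + f.coeff 2 * x ^ 2 + f.coeff 1 * x + f.coeff 0 := by
    rw [eval_eq_sum_range, hdeg]; simp [Finset.sum_range_succ]; ring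
  have hpf : (p : ℤ) ∣ f.eval x := hxy ▸ hpd.mul_right _
  have hαint : IsIntegral ℚ α := Algebra.IsIntegral.isIntegral α
  have hdegα : (minpoly ℚ α).natDegree = 3 := by
    have hr : aeval α (f.map (Int.castRingHom ℚ)) = 0 := by
      have := aeval_map_algebraMap ℚ α f
      rw [hroot] at this
      exact this
    have h1 := minpoly.eq_of_irreducible hirr hr
    rw [← h1, natDegree_mul_C, natDegree_map_eq_of_injective Int.cast_injective, hdeg]
    exact inv_ne_zero (leadingCoeff_ne_zero.2 hirr.ne_zero)
  have hfin : Module.finrank ℚ K = 3 := by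
    rw [← hdegα]; exact ((Field.primitive_element_iff_minpoly_natDegree_eq ℚ α).1 hgen).symm
  have hfx0 : f.eval x ≠ 0 := by
    rw [← hxy]
    exact mul_ne_zero hsq.ne_zero (pow_ne_zero 2 hy)
  have hr : aeval α f = 0 := hroot
  rw [aeval_eq_sum_range, hdeg] at hr
  simp [Finset.sum_range_succ] at hr
  rw [hfx] at hpf hfx0
  generalize f.coeff 3 = a at *
  generalize f.coeff 2 = b at *
  generalize f.coeff 1 = c at *
  generalize f.coeff 0 = e at *
  have haK : (a : K) ≠ 0 := by exact_mod_cast ha0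
  obtain ⟨A, hA⟩ : ∃ A : ℤ, A = 3 * a * x + b := ⟨_, rfl⟩
  obtain ⟨B, hB⟩ : ∃ B : ℤ, B = 3 * a * x ^ 2 + 2 * b * x + c := ⟨_, rfl⟩
  obtain ⟨D, hD⟩ : ∃ D : ℤ, D = a * x ^ 3 + b * x ^ 2 + c * x + e := ⟨_, rfl⟩
  rw [← hD] at hpf hfx0
  have key : ¬ (p : ℤ) ∣ a * B := by
    intro h
    have hpB := (hpp.dvd_or_dvd h).resolve_left hlc
    apply hdisc
    have : 18 * a * b * c * e - 4 * b ^ 3 * e + b ^ 2 * c ^ 2 - 4 * a * c ^ 3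
        - 27 * a ^ 2 * e ^ 2
        = B * (18 * a * A * D + A ^ 2 * B - 4 * a * B ^ 2) + D * (- 4 * A ^ 3 - 27 * a ^ 2 * D) := by
      subst hA hB hD; ring
    rw [this]
    exact dvd_add (hpB.mul_right _) (hpf.mul_right _)
  obtain ⟨η, hη⟩ : ∃ η : K, η = a * (α - x) := ⟨_, rfl⟩
  have hηeq : η ^ 3 + A * η ^ 2 + (a * B : ℤ) * η + (a ^ 2 * D : ℤ) = 0 := by
    subst hη hA hB hD; push_cast; linear_combination (a : K) ^ 2 * hr
  have hηint : IsIntegral ℤ η := by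
    refine ⟨X ^ 3 + C A * X ^ 2 + C (a * B) * X + C (a ^ 2 * D), by monicity!, ?_⟩
    simp only [eval₂_add, eval₂_mul, eval₂_C, eval₂_X, eval₂_pow]
    exact hηeq
  have hCK : ((a ^ 2 * D : ℤ) : K) ≠ 0 := by
    exact_mod_cast mul_ne_zero (pow_ne_zero 2 ha0) hfx0
  have hη0 : η ≠ 0 := by
    rintro rfl
    apply hCK
    simpa using hηeq
  obtain ⟨κ, hκ⟩ : ∃ κ : K, κ = η ^ 2 + A * η + (a * B : ℤ) := ⟨_, rfl⟩
  have hmul : η * κ = - (a ^ 2 * D : ℤ) := by rw [hκ]; linear_combination hηeq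
  have hκint : IsIntegral ℤ κ := by
    rw [hκ]
    exact ((hηint.pow 2).add ((isIntegral_algebraMap (x := A)).mul hηint)).add
      (isIntegral_algebraMap (x := a * B))
  have hκ0 : κ ≠ 0 := by
    rintro rfl
    apply hCK
    simpa using hmul
  have hgη : IntermediateField.adjoin ℚ {η} = ⊤ := by
    rw [eq_top_iff, ← hgen, IntermediateField.adjoin_simple_le_iff]
    have : α = η / a + x := by rw [hη]; field_simp; ring
    rw [this]
    exact add_mem (div_mem (IntermediateField.mem_adjoin_simple_self ℚ η) (intCast_mem _ a))
      (intCast_mem _ x)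
  have hgκ : IntermediateField.adjoin ℚ {κ} = ⊤ := by
    rw [eq_top_iff, ← hgη, IntermediateField.adjoin_simple_le_iff]
    have : η = (- (a ^ 2 * D) : ℤ) / κ := by
      rw [eq_div_iff hκ0, hmul]; push_cast; ring
    rw [this]
    exact div_mem (intCast_mem _ _) (IntermediateField.mem_adjoin_simple_self ℚ κ)
  have hκeq : κ ^ 3 + (- (a * B) : ℤ) * κ ^ 2 + (A * (a ^ 2 * D) : ℤ) * κ
      + (- (a ^ 2 * D) ^ 2 : ℤ) = 0 := by
    have h3 : (η * κ) ^ 2 = ((a ^ 2 * D : ℤ) : K) ^ 2 := by rw [hmul]; ring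
    push_cast at h3 hκ hmul ⊢
    linear_combination κ ^ 2 * hκ + h3 + A * κ * hmul
  let η' : NumberField.RingOfIntegers K := ⟨η, hηint⟩
  let κ' : NumberField.RingOfIntegers K := ⟨κ, hκint⟩
  have hmem : η' * κ' ∈ Ideal.span {(p : NumberField.RingOfIntegers K)} := by
    obtain ⟨k, hk⟩ := hpf
    rw [Ideal.mem_span_singleton]
    refine ⟨((- (a ^ 2 * k) : ℤ) : NumberField.RingOfIntegers K), ?_⟩
    apply FaithfulSMul.algebraMap_injective (NumberField.RingOfIntegers K) K
    have : (η * κ : K) = (p : K) * ((- (a ^ 2 * k) : ℤ) : K) := by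
      rw [hmul, hk]; push_cast; ring
    rw [map_mul, map_mul, map_natCast, map_intCast]
    exact this
  rcases hinert.mem_or_mem hmem with h | h
  · obtain ⟨γ, hγ⟩ := Ideal.mem_span_singleton.1 h
    have h1 : η = ((p : ℤ) : K) * (γ : K) := by
      have := congrArg (algebraMap (NumberField.RingOfIntegers K) K) hγ
      rw [map_mul, map_natCast] at this
      rw [Int.cast_natCast]
      exact this
    exact key (cubic_aux K hfin η γ p hp0 γ.2 h1 hgη _ _ _ hηeq).2
  · obtain ⟨γ, hγ⟩ := Ideal.mem_span_singleton.1 h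
    have h1 : κ = ((p : ℤ) : K) * (γ : K) := by
      have := congrArg (algebraMap (NumberField.RingOfIntegers K) K) hγ
      rw [map_mul, map_natCast] at this
      rw [Int.cast_natCast]
      exact this
    exact key ((dvd_neg).1 (cubic_aux K hfin κ γ p hp0 γ.2 h1 hgκ _ _ _ hκeq).1)
end
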